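/- The closed ball of radius M in H^1((0,1)) (functions with ‖u‖_{L^2} + ‖u'‖_{L^2} ≤ M) is a totally bounded (precompact) subset of L^2((0,1)). -/

import Mathlib

open MeasureTheory
open Set

/-- primitive of a compactly supported smooth function with zero mean -/
lemma aux_prim (w : ℝ → ℝ) (hw : ContDiff ℝ (⊤ : ℕ∞) w) (hc : HasCompactSupport w)
    (hs : tsupport w ⊆ Ioo (0:ℝ) 1) (h0 : ∫ x in (0:ℝ)..1, w x = 0) :
    ∃ φ : ℝ → ℝ, ContDiff ℝ (⊤ : ℕ∞) φ ∧ HasCompactSupport φ ∧ tsupport φ ⊆ Ioo (0:ℝ) 1 ∧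
      deriv φ = w := by
  have hcont : Continuous w := hw.continuous
  have hd : ∀ x, HasDerivAt (fun x => ∫ t in (0:ℝ)..x, w t) (w x) x := fun x =>
    intervalIntegral.integral_hasDerivAt_right (hcont.intervalIntegrable _ _)
      (hcont.stronglyMeasurableAtFilter _ _) hcont.continuousAt
  have hderiv : deriv (fun x => ∫ t in (0:ℝ)..x, w t) = w := funext fun x => (hd x).deriv
  obtain ⟨a, b, ha, hb, hab⟩ : ∃ a b : ℝ, 0 < a ∧ b < 1 ∧ tsupport w ⊆ Icc a b := by
    rcases (tsupport w).eq_empty_or_nonempty with he | hne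
    · exact ⟨1/2, 1/2, by norm_num, by norm_num, by simp [he]⟩
    · have hK : IsCompact (tsupport w) := hc
      obtain ⟨a, haK, ha⟩ := hK.exists_isLeast hne
      obtain ⟨b, hbK, hb⟩ := hK.exists_isGreatest hne
      exact ⟨a, b, (hs haK).1, (hs hbK).2, fun x hx => ⟨ha hx, hb hx⟩⟩
  have hz : ∀ x, x ∉ Icc a b → w x = 0 := fun x hx => by
    by_contra hne
    exact hx (hab (subset_tsupport _ hne))
  have hsupp : tsupport (fun x => ∫ t in (0:ℝ)..x, w t) ⊆ Icc a b := by
    refine closure_minimal ?_ isClosed_Icc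
    intro x hx
    by_contra hxab
    apply hx
    by_cases hxa : x < a
    · show ∫ t in (0:ℝ)..x, w t = 0
      rw [intervalIntegral.integral_congr (g := fun _ => (0:ℝ))]
      · simp
      · intro t ht
        apply hz
        intro h
        have h1 := ht.2
        have : max 0 x < a := max_lt ha hxa
        have h2 := h.1
        linarith
    · have hxb : b < x := by
        by_contra hh
        exact hxab ⟨by linarith, by linarith⟩
      show ∫ t in (0:ℝ)..x, w t = 0
      rw [← intervalIntegral.integral_add_adjacent_intervals (hcont.intervalIntegrable 0 1)
        (hcont.intervalIntegrable 1 x), h0, zero_add]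
      rw [intervalIntegral.integral_congr (g := fun _ => (0:ℝ))]
      · simp
      · intro t ht
        apply hz
        intro h
        have h1 := ht.1
        have : b < min 1 x := lt_min hb hxb
        have h2 := h.2
        linarith
  refine ⟨fun x => ∫ t in (0:ℝ)..x, w t, ?_, ?_, ?_, hderiv⟩
  · have := (contDiff_infty_iff_deriv (𝕜 := ℝ) (f := fun x => ∫ t in (0:ℝ)..x, w t)).2
      ⟨fun x => (hd x).differentiableAt, by rw [hderiv]; exact hw⟩
    exact this
  · exact isCompact_Icc.of_isClosed_subset (isClosed_tsupport _) hsupp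
  · exact hsupp.trans fun x hx => ⟨by linarith [hx.1], by linarith [hx.2]⟩

lemma aux_integral_Ioo (F : ℝ → ℝ) : ∫ x in Ioo (0:ℝ) 1, F x = ∫ x in (0:ℝ)..1, F x := by
  rw [intervalIntegral.integral_of_le zero_le_one, integral_Ioc_eq_integral_Ioo]

lemma aux_dubois (h : ℝ → ℝ) (hi : IntervalIntegrable h volume 0 1)
    (H : ∀ φ : ℝ → ℝ, ContDiff ℝ (⊤ : ℕ∞) φ → HasCompactSupport φ →
          tsupport φ ⊆ Ioo (0:ℝ) 1 → ∫ x in (0:ℝ)..1, h x * deriv φ x = 0) :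
    ∃ c : ℝ, ∀ᵐ x, x ∈ Ioo (0:ℝ) 1 → h x = c := by
  let B : ContDiffBump (1/2 : ℝ) := ⟨1/8, 1/4, by norm_num, by norm_num⟩
  let ρ := B.normed volume
  have hρs : ContDiff ℝ (⊤ : ℕ∞) ρ := B.contDiff_normed
  have hρc : HasCompactSupport ρ := B.hasCompactSupport_normed
  have hρt : tsupport ρ ⊆ Ioo (0:ℝ) 1 := by
    rw [B.tsupport_normed_eq, Real.closedBall_eq_Icc]
    intro x hx
    have h1 := hx.1
    have h2 := hx.2
    simp only [B] at h1 h2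
    constructor <;> linarith
  have full : ∀ F : ℝ → ℝ, tsupport F ⊆ Ioo (0:ℝ) 1 → ∫ x, F x = ∫ x in (0:ℝ)..1, F x := by
    intro F hF
    rw [← aux_integral_Ioo, setIntegral_eq_integral_of_forall_compl_eq_zero]
    intro x hx
    by_contra hne
    exact hx (hF (subset_tsupport _ hne))
  have hρ1 : ∫ x in (0:ℝ)..1, ρ x = 1 := by
    rw [← full ρ hρt]; exact B.integral_normed
  refine ⟨∫ x in (0:ℝ)..1, h x * ρ x, ?_⟩
  set c := ∫ x in (0:ℝ)..1, h x * ρ x with hcdef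
  have hiO : IntegrableOn h (Ioo 0 1) volume :=
    ((intervalIntegrable_iff_integrableOn_Ioo_of_le zero_le_one).1 hi)
  have key := isOpen_Ioo.ae_eq_zero_of_integral_contDiff_smul_eq_zero (U := Ioo (0:ℝ) 1)
    (f := fun x => h x - c) (μ := volume)
    (by
      apply IntegrableOn.locallyIntegrableOn
      exact hiO.sub (integrableOn_const (by simp)))
    (by
      intro ψ hψ hψc hψt
      rw [full]
      swap
      · exact (tsupport_smul_subset_left ψ _).trans hψt
      set m := ∫ x in (0:ℝ)..1, ψ x with hm
      have hwc : HasCompactSupport (fun x => ψ x - m * ρ x) :=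
        hψc.sub (hρc.mul_left (f := fun _ => m))
      have hwt : tsupport (fun x => ψ x - m * ρ x) ⊆ Ioo (0:ℝ) 1 := by
        refine (tsupport_sub ψ (fun x => m * ρ x)).trans (union_subset hψt ?_)
        exact (tsupport_mul_subset_right (f := fun _ => m)).trans hρt
      have hψI : IntervalIntegrable ψ volume 0 1 := hψ.continuous.intervalIntegrable _ _
      have hρI : IntervalIntegrable ρ volume 0 1 := hρs.continuous.intervalIntegrable _ _
      obtain ⟨φ, p1, p2, p3, p4⟩ := aux_prim (fun x => ψ x - m * ρ x)
        (hψ.sub (contDiff_const.mul hρs)) hwc hwt (by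
          rw [intervalIntegral.integral_sub hψI (hρI.const_mul m),
            intervalIntegral.integral_const_mul, hρ1]; simp [hm])
      have := H φ p1 p2 p3
      rw [p4] at this
      have hhψ : IntervalIntegrable (fun x => h x * ψ x) volume 0 1 :=
        hi.mul_continuousOn hψ.continuous.continuousOn
      have hhρ : IntervalIntegrable (fun x => h x * ρ x) volume 0 1 :=
        hi.mul_continuousOn hρs.continuous.continuousOn
      have e1 : ∫ x in (0:ℝ)..1, h x * (ψ x - m * ρ x) =
          (∫ x in (0:ℝ)..1, h x * ψ x) - m * c := by
        rw [hcdef, ← intervalIntegral.integral_const_mul,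
          ← intervalIntegral.integral_sub hhψ (hhρ.const_mul m)]
        congr 1; ext x; ring
      have e2 : ∫ x in (0:ℝ)..1, ψ x • (h x - c) =
          (∫ x in (0:ℝ)..1, h x * ψ x) - c * m := by
        rw [hm, ← intervalIntegral.integral_const_mul,
          ← intervalIntegral.integral_sub hhψ (hψI.const_mul c)]
        congr 1; ext x; simp only [smul_eq_mul]; ring
      rw [e2]; rw [e1] at this; linarith)
  filter_upwards [key] with x hx hx1
  linarith [hx hx1]

lemma aux_rep (f g : ℝ → ℝ) (hf : IntervalIntegrable f volume 0 1)
    (hg : IntervalIntegrable g volume 0 1)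
    (H : ∀ φ : ℝ → ℝ, ContDiff ℝ (⊤ : ℕ∞) φ → HasCompactSupport φ →
          tsupport φ ⊆ Set.Ioo (0:ℝ) 1 →
          ∫ x in Set.Ioo (0:ℝ) 1, f x * deriv φ x =
            - ∫ x in Set.Ioo (0:ℝ) 1, g x * φ x) :
    ∃ c : ℝ, ∀ᵐ x, x ∈ Ioo (0:ℝ) 1 → f x = c + ∫ t in (0:ℝ)..x, g t := by
  have hAC := hg.absolutelyContinuousOnInterval_intervalIntegral (c := 0) (by simp)
  have hGc := hAC.continuousOn
  obtain ⟨c, hc⟩ := aux_dubois (fun x => f x - ∫ t in (0:ℝ)..x, g t)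
    (hf.sub hGc.intervalIntegrable) (by
      intro φ h1 h2 h3
      have e := H φ h1 h2 h3
      rw [aux_integral_Ioo, aux_integral_Ioo] at e
      have hφ1 : ContDiff ℝ 1 φ := h1.of_le (by exact_mod_cast le_top)
      have hdc : Continuous (deriv φ) := hφ1.continuous_deriv_one
      have ip := hAC.integral_mul_deriv_eq_deriv_mul hφ1.contDiffOn.absolutelyContinuousOnInterval
      have z0 : φ 0 = 0 := by
        by_contra hne
        exact (lt_irrefl _ (h3 (subset_tsupport _ hne)).1)
      have z1 : φ 1 = 0 := by
        by_contra hne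
        exact (lt_irrefl _ (h3 (subset_tsupport _ hne)).2)
      have e3 : ∫ x in (0:ℝ)..1, deriv (fun x => ∫ t in (0:ℝ)..x, g t) x * φ x
          = ∫ x in (0:ℝ)..1, g x * φ x := by
        apply intervalIntegral.integral_congr_ae
        filter_upwards [hg.ae_hasDerivAt_integral] with x hx hx'
        rw [(hx (uIoc_subset_uIcc hx') 0 (by simp)).deriv]
      rw [e3, z0, z1] at ip
      have hGd : IntervalIntegrable (fun x => (∫ t in (0:ℝ)..x, g t) * deriv φ x) volume 0 1 :=
        (hGc.mul hdc.continuousOn).intervalIntegrable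
      simp only [sub_mul]
      rw [intervalIntegral.integral_sub (hf.mul_continuousOn hdc.continuousOn)
        hGd, e, ip]
      ring)
  refine ⟨c, ?_⟩
  filter_upwards [hc] with x hx hx1
  linarith [hx hx1]

lemma aux_holder (f : Lp ℝ 2 (volume.restrict (Ioo (0:ℝ) 1))) {x y : ℝ} (hx : 0 ≤ x)
    (hxy : x ≤ y) (hy : y ≤ 1) : |∫ t in x..y, f t| ≤ ‖f‖ * √(y - x) := by
  have hsub : Ioo x y ⊆ Ioo (0:ℝ) 1 := Ioo_subset_Ioo hx hy
  have hms : (volume.restrict (Ioo (0:ℝ) 1)) (Ioo x y) ≠ ⊤ := measure_ne_top _ _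
  have h1 := L2.inner_indicatorConstLp_one (𝕜 := ℝ) measurableSet_Ioo hms f
  rw [Measure.restrict_restrict measurableSet_Ioo, inter_eq_self_of_subset_left hsub] at h1
  rw [intervalIntegral.integral_of_le hxy, integral_Ioc_eq_integral_Ioo, ← h1]
  refine (abs_real_inner_le_norm _ _).trans ?_
  rw [norm_indicatorConstLp (by simp) (by simp), mul_comm, measureReal_restrict_apply measurableSet_Ioo,
    inter_eq_self_of_subset_left hsub, Real.volume_real_Ioo_of_le hxy, Real.sqrt_eq_rpow]
  simp

lemma aux_int (f : Lp ℝ 2 (volume.restrict (Ioo (0:ℝ) 1))) :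
    IntervalIntegrable f volume 0 1 := by
  rw [intervalIntegrable_iff_integrableOn_Ioo_of_le zero_le_one]
  exact (Lp.memLp f).integrable (by norm_num)

/-- continuous representative -/
lemma aux_main (M : ℝ) (f g : Lp ℝ 2 (volume.restrict (Ioo (0:ℝ) 1)))
    (H : ∀ φ : ℝ → ℝ, ContDiff ℝ (⊤ : ℕ∞) φ → HasCompactSupport φ →
          tsupport φ ⊆ Set.Ioo (0:ℝ) 1 →
          ∫ x in Set.Ioo (0:ℝ) 1, f x * deriv φ x =
            - ∫ x in Set.Ioo (0:ℝ) 1, g x * φ x) (hM : ‖f‖ + ‖g‖ ≤ M) :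
    ∃ u : ℝ → ℝ, (∀ᵐ x, x ∈ Ioo (0:ℝ) 1 → f x = u x) ∧
      (∀ x ∈ Icc (0:ℝ) 1, |u x| ≤ 2 * M) ∧
      (∀ x ∈ Icc (0:ℝ) 1, ∀ y ∈ Icc (0:ℝ) 1, |u x - u y| ≤ M * √|x - y|) := by
  obtain ⟨c, hc⟩ := aux_rep f g (aux_int f) (aux_int g) H
  have hgi := aux_int g
  have hAC := hgi.absolutelyContinuousOnInterval_intervalIntegral (c := 0) (by simp)
  have hGc := hAC.continuousOn
  have nf := norm_nonneg f
  have ng := norm_nonneg g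
  have hGb : ∀ x ∈ Icc (0:ℝ) 1, |∫ t in (0:ℝ)..x, g t| ≤ ‖g‖ := by
    intro x hx
    refine (aux_holder g le_rfl hx.1 hx.2).trans ?_
    have : √(x - 0) ≤ 1 := Real.sqrt_le_one.2 (by linarith [hx.2])
    nlinarith
  have hcb : |c| ≤ M := by
    have e : ∫ x in (0:ℝ)..1, f x = ∫ x in (0:ℝ)..1, (c + ∫ t in (0:ℝ)..x, g t) := by
      rw [← aux_integral_Ioo, ← aux_integral_Ioo]
      exact setIntegral_congr_ae measurableSet_Ioo hc
    rw [intervalIntegral.integral_add (by simp) hGc.intervalIntegrable] at e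
    simp only [intervalIntegral.integral_const, sub_zero, one_smul] at e
    have b1 := aux_holder f le_rfl zero_le_one le_rfl
    have b2 : ‖∫ x in (0:ℝ)..1, ∫ t in (0:ℝ)..x, g t‖ ≤ ‖g‖ * |(1:ℝ) - 0| := by
      apply intervalIntegral.norm_integral_le_of_norm_le_const
      intro x hx
      rw [uIoc_of_le zero_le_one] at hx
      exact hGb x ⟨hx.1.le, hx.2⟩
    simp only [sub_zero, Real.sqrt_one, abs_one, mul_one, Real.norm_eq_abs] at b1 b2
    rw [abs_le] at *
    constructor <;> linarith
  refine ⟨fun x => c + ∫ t in (0:ℝ)..x, g t, hc, ?_, ?_⟩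
  · intro x hx
    have := hGb x hx
    have := abs_add_le c (∫ t in (0:ℝ)..x, g t)
    show |c + ∫ t in (0:ℝ)..x, g t| ≤ _
    linarith
  · have main : ∀ x ∈ Icc (0:ℝ) 1, ∀ y ∈ Icc (0:ℝ) 1, x ≤ y →
        |(c + ∫ t in (0:ℝ)..x, g t) - (c + ∫ t in (0:ℝ)..y, g t)| ≤ M * √|x - y| := by
      intro x hx y hy hxy
      have hI : ∀ z ∈ Icc (0:ℝ) 1, IntervalIntegrable g volume 0 z := fun z hz =>
        hgi.mono_set (by
          rw [uIcc_of_le hz.1, uIcc_of_le zero_le_one]; exact Icc_subset_Icc_right hz.2)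
      rw [add_sub_add_left_eq_sub, abs_sub_comm,
        intervalIntegral.integral_interval_sub_left (hI y hy) (hI x hx), abs_sub_comm x y,
        abs_of_nonneg (sub_nonneg.2 hxy)]
      refine (aux_holder g hx.1 hxy hy.2).trans ?_
      have := Real.sqrt_nonneg (y - x)
      nlinarith
    intro x hx y hy
    rcases le_total x y with h | h
    · exact main x hx y hy h
    · have := main y hy x hx h
      rw [abs_sub_comm, abs_sub_comm x y]
      exact this

theorem stmt12 (M : ℝ) (hM : 0 < M) :
    TotallyBounded {f : Lp ℝ 2 (volume.restrict (Set.Ioo (0:ℝ) 1)) |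
      ∃ g : Lp ℝ 2 (volume.restrict (Set.Ioo (0:ℝ) 1)),
        (∀ φ : ℝ → ℝ, ContDiff ℝ (⊤ : ℕ∞) φ → HasCompactSupport φ →
          tsupport φ ⊆ Set.Ioo (0:ℝ) 1 →
          ∫ x in Set.Ioo (0:ℝ) 1, f x * deriv φ x =
            - ∫ x in Set.Ioo (0:ℝ) 1, g x * φ x) ∧
        ‖f‖ + ‖g‖ ≤ M} := by
  let A : Set (BoundedContinuousFunction (Icc (0:ℝ) 1) ℝ) :=
    {u | (∀ x, |u x| ≤ 2 * M) ∧ ∀ x y, |u x - u y| ≤ M * √(dist x y)}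
  have hA : IsCompact (closure A) := by
    refine BoundedContinuousFunction.arzela_ascoli (Icc (-(2*M)) (2*M)) isCompact_Icc A ?_ ?_
    · intro u x hu
      exact abs_le.1 (hu.1 x)
    · apply UniformEquicontinuous.equicontinuous
      apply Metric.uniformEquicontinuous_of_continuity_modulus (fun d => M * √d)
      · have : Continuous (fun d : ℝ => M * √d) := by fun_prop
        simpa using this.tendsto 0
      · intro x y u
        exact u.2.2 x y
  let P : C(ℝ, Icc (0:ℝ) 1) := ⟨projIcc 0 1 zero_le_one, continuous_projIcc⟩
  let Φ : BoundedContinuousFunction (Icc (0:ℝ) 1) ℝ → Lp ℝ 2 (volume.restrict (Ioo (0:ℝ) 1)) :=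
    fun u => BoundedContinuousFunction.toLp 2 (volume.restrict (Ioo (0:ℝ) 1)) ℝ (u.compContinuous P)
  have hΦ : Continuous Φ :=
    (ContinuousLinearMap.continuous _).comp (BoundedContinuousFunction.continuous_compContinuous P)
  refine ((hA.image hΦ).totallyBounded).subset ?_
  rintro f ⟨g, H, hb⟩
  obtain ⟨u, h1, h2, h3⟩ := aux_main M f g H hb
  have hcont : Continuous (fun x : Icc (0:ℝ) 1 => u x) := by
    rw [Metric.continuous_iff']
    intro x ε hε
    have : Continuous (fun y : Icc (0:ℝ) 1 => M * √|(y:ℝ) - x|) := by fun_prop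
    have := this.tendsto x
    simp only [sub_self, abs_zero, Real.sqrt_zero, mul_zero] at this
    filter_upwards [this.eventually (gt_mem_nhds hε)] with y hy
    exact (h3 y y.2 x x.2).trans_lt hy
  refine ⟨BoundedContinuousFunction.mkOfCompact ⟨_, hcont⟩, subset_closure ⟨fun x => h2 x x.2, fun x y => h3 x x.2 y y.2⟩, ?_⟩
  apply Lp.ext
  refine (BoundedContinuousFunction.coeFn_toLp 2 (volume.restrict (Ioo (0:ℝ) 1)) ℝ _).trans ?_
  refine ((ae_restrict_iff' measurableSet_Ioo).2 ?_)
  filter_upwards [h1] with x hx hx1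
  rw [hx hx1]
  have : projIcc (0:ℝ) 1 zero_le_one x = ⟨x, Ioo_subset_Icc_self hx1⟩ :=
    projIcc_of_mem _ (Ioo_subset_Icc_self hx1)
  simp [P, this]
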